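/- arXiv:2511.06068 — 3 statements merged into one kernel-verified Lean document; each statement's English description precedes it below -/
import Mathlib

section
/- Let 𝔤 be a Lie ring whose almost centre Z̃(𝔤) is finite. Then Z̃(𝔤) is a (finite) Lie ideal of 𝔤, and the quotient Lie ring 𝔤/Z̃(𝔤) has trivial almost centre: every element of 𝔤/Z̃(𝔤) whose centraliser has finite index in the additive group of 𝔤/Z̃(𝔤) is zero. -/
/-- The centraliser `C_𝔤(x) = {y ∈ 𝔤 : ⁅x, y⁆ = 0}` of an element of a Lie ring, as an
additive subgroup of `(𝔤, +)`. -/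
def ringCent (L : Type*) [LieRing L] (x : L) : AddSubgroup L where
  carrier := {y : L | ⁅x, y⁆ = 0}
  zero_mem' := lie_zero x
  add_mem' := by
    intro a b ha hb
    simp only [Set.mem_setOf_eq] at *
    rw [lie_add, ha, hb, add_zero]
  neg_mem' := by
    intro a ha
    simp only [Set.mem_setOf_eq] at *
    rw [lie_neg, ha, neg_zero]

theorem aux_mem_ringCent {L : Type*} [LieRing L] {x y : L} : y ∈ ringCent L x ↔ ⁅x, y⁆ = 0 := Iff.rfl

/-- Bracketing with `x` as an additive map. -/
def auxAd {L : Type*} [LieRing L] (x : L) : L →+ L where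
  toFun y := ⁅x, y⁆
  map_zero' := lie_zero x
  map_add' := lie_add x

theorem aux_comap {A B : Type*} [AddCommGroup A] [AddCommGroup B] (f : A →+ B)
    (H : AddSubgroup B) (h : H.FiniteIndex) : (H.comap f).FiniteIndex := by
  constructor
  rw [AddSubgroup.index_comap]
  intro h0
  exact h.index_ne_zero (Nat.eq_zero_of_zero_dvd (h0 ▸ AddSubgroup.relIndex_dvd_index_of_normal H f.range))

/-- Let `𝔤` be a Lie ring whose almost centre `Z̃(𝔤) = {x : C_𝔤(x) has finite index in (𝔤,+)}`
is finite.  Then `Z̃(𝔤)` is a (finite) Lie ideal of `𝔤`, and the quotient Lie ring `𝔤/Z̃(𝔤)`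
has trivial almost centre: every element of `𝔤/Z̃(𝔤)` whose centraliser has finite index in
the additive group of `𝔤/Z̃(𝔤)` is zero. -/
theorem quotient_by_finite_almostCentre_has_trivial_almostCentre
    (L : Type*) [LieRing L]
    (hfin : {x : L | (ringCent L x).FiniteIndex}.Finite) :
    ∃ I : LieIdeal ℤ L,
      (I : Set L) = {x : L | (ringCent L x).FiniteIndex} ∧
      ∀ z : L ⧸ I, (ringCent (L ⧸ I) z).FiniteIndex → z = 0 := by
  let I : LieIdeal ℤ L :=
    { carrier := {x : L | (ringCent L x).FiniteIndex}
      zero_mem' := by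
        have : ringCent L 0 = ⊤ := by
          ext y; simp [aux_mem_ringCent]
        simp only [Set.mem_setOf_eq]
        rw [this]; infer_instance
      add_mem' := by
        intro a b ha hb
        simp only [Set.mem_setOf_eq] at *
        have : (ringCent L a ⊓ ringCent L b).FiniteIndex := inferInstance
        refine AddSubgroup.finiteIndex_of_le (H := ringCent L a ⊓ ringCent L b) ?_
        rintro y ⟨h1, h2⟩
        have h1 := aux_mem_ringCent.1 h1
        have h2 := aux_mem_ringCent.1 h2
        rw [aux_mem_ringCent, add_lie, h1, h2, add_zero]
      smul_mem' := by
        intro n a ha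
        simp only [Set.mem_setOf_eq] at *
        refine AddSubgroup.finiteIndex_of_le (H := ringCent L a) ?_
        intro y h1
        have h1 := aux_mem_ringCent.1 h1
        rw [aux_mem_ringCent, smul_lie, h1, smul_zero]
      lie_mem := by
        intro g x hx
        change (ringCent L x).FiniteIndex at hx
        change (ringCent L ⁅g, x⁆).FiniteIndex
        have h2 : ((ringCent L x).comap (auxAd g)).FiniteIndex := aux_comap _ _ hx
        refine AddSubgroup.finiteIndex_of_le
          (H := ringCent L x ⊓ (ringCent L x).comap (auxAd g)) ?_
        rintro y ⟨h1, h2⟩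
        have h1 : ⁅x, y⁆ = 0 := h1
        have h2 : ⁅x, ⁅g, y⁆⁆ = 0 := h2
        rw [aux_mem_ringCent, lie_lie, h1, h2, lie_zero, sub_zero] }
  have hI : (I : Set L) = {x : L | (ringCent L x).FiniteIndex} := rfl
  refine ⟨I, hI, ?_⟩
  intro z hz
  obtain ⟨x, rfl⟩ := LieSubmodule.Quotient.surjective_mk' I z
  rw [LieSubmodule.Quotient.mk_eq_zero]
  change (ringCent L x).FiniteIndex
  let m : L →+ L ⧸ I := (LieSubmodule.Quotient.mk' I : L →ₗ[ℤ] L ⧸ I).toAddMonoidHom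
  set K := (ringCent (L ⧸ I) (LieSubmodule.Quotient.mk' I x)).comap m with hK
  have hKf : K.FiniteIndex := aux_comap _ _ hz
  have hKI : (K.map (auxAd x) : Set L) ⊆ I := by
    rintro _ ⟨y, hy, rfl⟩
    have hy : ⁅LieSubmodule.Quotient.mk' I x, LieSubmodule.Quotient.mk' I y⁆ = 0 := hy
    have h3 : LieSubmodule.Quotient.mk' I ⁅x, y⁆ = 0 := hy
    exact (LieSubmodule.Quotient.mk_eq_zero I).1 h3
  have hfinK : Finite (K.map (auxAd x)) := (hfin.subset hKI).to_subtype
  have hC : ringCent L x = (⊥ : AddSubgroup L).comap (auxAd x) := rfl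
  have hle : ringCent L x ≤ K := by
    intro y hy
    have hy : ⁅x, y⁆ = 0 := hy
    change LieSubmodule.Quotient.mk' I ⁅x, y⁆ = 0
    rw [hy, map_zero]
  constructor
  rw [← AddSubgroup.relIndex_mul_index hle]
  refine mul_ne_zero ?_ hKf.index_ne_zero
  rw [hC, AddSubgroup.relIndex_comap, AddSubgroup.relIndex_bot_left]
  exact Nat.card_pos.ne'
end

section
/- Let p be a prime and 𝔤 a Lie ring of characteristic p, i.e. p·x = 0 for every x ∈ 𝔤. Then for every g ∈ 𝔤 and every i ∈ ℕ, the set C^{p^i}(g) = {h ∈ 𝔤 : ad_g^{p^i}(h) = 0}, where ad_g(y) = ⁅g,y⁆, is a Lie subring of 𝔤 (an additive subgroup closed under the bracket). -/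
/-- Let `p` be a prime and `𝔤` a Lie ring of characteristic `p`, i.e. `p • x = 0` for every
`x ∈ 𝔤`.  Then for every `g ∈ 𝔤` and every `i ∈ ℕ`, the set
`C^{p^i}(g) = {h ∈ 𝔤 : ad_g^[p^i] h = 0}`, where `ad_g y = ⁅g, y⁆`, is a Lie subring of `𝔤`
(an additive subgroup closed under the bracket). -/
theorem ker_iterated_ad_pow_prime_is_subring
    (L : Type*) [LieRing L] (p : ℕ) (hp : p.Prime)
    (hchar : ∀ x : L, p • x = 0) (g : L) (i : ℕ) :
    ∃ S : AddSubgroup L,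
      ((S : Set L) = {h : L | (fun y : L => ⁅g, y⁆)^[p ^ i] h = 0}) ∧
      ∀ a ∈ S, ∀ b ∈ S, ⁅a, b⁆ ∈ S := by
  have hf : ∀ (n : ℕ) (x : L), (fun y : L => ⁅g, y⁆)^[n] x = ((LieAlgebra.ad ℤ L g) ^ n) x := by
    intro n x
    rw [Module.End.pow_apply]
    rfl
  refine ⟨(LinearMap.ker ((LieAlgebra.ad ℤ L g) ^ (p ^ i))).toAddSubgroup, ?_, ?_⟩
  · ext x
    simp [hf]
  · intro a ha b hb
    have ha' : ((LieAlgebra.ad ℤ L g) ^ (p ^ i)) a = 0 := ha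
    have hb' : ((LieAlgebra.ad ℤ L g) ^ (p ^ i)) b = 0 := hb
    change ((LieAlgebra.ad ℤ L g) ^ (p ^ i)) ⁅a, b⁆ = 0
    rw [LieAlgebra.ad_pow_lie]
    refine Finset.sum_eq_zero fun ij hij => ?_
    rw [Finset.HasAntidiagonal.mem_antidiagonal] at hij
    by_cases h1 : ij.1 = 0
    · have h2 : ij.2 = p ^ i := by omega
      rw [h2, hb', lie_zero, smul_zero]
    by_cases h2 : ij.1 = p ^ i
    · rw [h2, ha', zero_lie, smul_zero]
    · obtain ⟨c, hc⟩ := hp.dvd_choose_pow h1 h2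
      rw [hc, mul_smul, hchar]
end

section
/- Let G be a group and A a finite normal subgroup of G such that the quotient G/A is connected, i.e. G/A has no proper subgroup of finite index. Then every subgroup H of finite index in G satisfies [G : H] ≤ |A|; consequently G possesses a smallest subgroup of finite index (G is virtually connected). -/
/-- Let `G` be a group and `A` a finite normal subgroup of `G` such that the quotient `G/A`
is connected, i.e. `G/A` has no proper subgroup of finite index.  Then every subgroup `H`
of finite index in `G` satisfies `[G : H] ≤ |A|`; consequently `G` possesses a smallest
subgroup of finite index (`G` is virtually connected). -/
theorem virtuallyConnected_of_quotient_by_finite_connected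
    (G : Type*) [Group G] (A : Subgroup G) [A.Normal] [Finite A]
    (hconn : ∀ H : Subgroup (G ⧸ A), H.index ≠ 0 → H = ⊤) :
    (∀ H : Subgroup G, H.index ≠ 0 → H.index ≤ Nat.card A) ∧
    ∃ B : Subgroup G, B.index ≠ 0 ∧ ∀ H : Subgroup G, H.index ≠ 0 → B ≤ H := by
  have key : ∀ H : Subgroup G, H.index ≠ 0 → H.index ≤ Nat.card A := by
    intro H hH
    have hs : Function.Surjective (QuotientGroup.mk' A) := QuotientGroup.mk'_surjective A
    have h1 : H.map (QuotientGroup.mk' A) = ⊤ := by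
      apply hconn
      intro h0
      have hd := Subgroup.index_map_dvd H hs
      rw [h0] at hd
      exact hH (Nat.eq_zero_of_zero_dvd hd)
    rw [Subgroup.index_eq_card]
    apply Nat.card_le_card_of_surjective (fun a : A => ((a : G) : G ⧸ H))
    intro q
    obtain ⟨g, rfl⟩ := QuotientGroup.mk_surjective q
    have hg : QuotientGroup.mk' A g⁻¹ ∈ H.map (QuotientGroup.mk' A) := by
      rw [h1]; trivial
    obtain ⟨h, hh, he⟩ := hg
    have ha : h⁻¹ * g⁻¹ ∈ A := QuotientGroup.eq.1 he
    have ha2 : g * h ∈ A := by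
      have := A.inv_mem ha
      simpa using this
    refine ⟨⟨g * h, ha2⟩, ?_⟩
    apply QuotientGroup.eq.2
    simpa using hh
  refine ⟨key, ?_⟩
  let S : Set ℕ := {n | ∃ H : Subgroup G, H.index ≠ 0 ∧ H.index = n}
  have hne : S.Nonempty := ⟨1, ⊤, by simp, by simp⟩
  have hbd : BddAbove S := by
    refine ⟨Nat.card A, ?_⟩
    rintro n ⟨H, hH, rfl⟩
    exact key H hH
  obtain ⟨B, hB, hBS⟩ := Nat.sSup_mem hne hbd
  refine ⟨B, hB, fun H hH => ?_⟩
  have hi : (B ⊓ H).index ≠ 0 := Subgroup.index_inf_ne_zero hB hH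
  have hle : (B ⊓ H).index ≤ B.index := hBS ▸ le_csSup hbd ⟨_, hi, rfl⟩
  have hm := Subgroup.relIndex_mul_index (inf_le_left : B ⊓ H ≤ B)
  have hr : (B ⊓ H).relIndex B = 1 := by
    have hr0 : (B ⊓ H).relIndex B ≠ 0 := by
      intro h; rw [h] at hm; omega
    have : (B ⊓ H).relIndex B * B.index ≤ 1 * B.index := by omega
    have := Nat.le_of_mul_le_mul_right this (Nat.pos_of_ne_zero hB)
    omega
  exact (Subgroup.relIndex_eq_one.1 hr).trans inf_le_right
end
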